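/- (Monotonicity with respect to the initial point.) Let ω ∈ Ω₊, let −∞ ≤ x ≤ y₁ ≤ y₂ ≤ z ≤ ∞ with y₁, y₂ ∈ ℤ, and let t ∈ [0, ∞]. Then P_{y₁,ω}[T_z ≤ T_x ∧ t] ≤ P_{y₂,ω}[T_z ≤ T_x ∧ t], where by convention T_∞ = T_{−∞} = ∞. -/

import Mathlib

open MeasureTheory Filter Set Topology ProbabilityTheory
open scoped ENNReal ENat

noncomputable section

/-- A cookie environment: `ω z i` is the strength of the `(i+1)`-st cookie at site `z`
(cookies at each site are indexed by `i = 0, 1, 2, …`). -/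
abbrev CEnv : Type := ℤ → ℕ → ℝ

/-- `ω` belongs to `Ω₊`, i.e. all cookie strengths lie in `[1/2, 1]`. -/
def IsCookieEnv (ω : CEnv) : Prop := ∀ z i, ω z i ∈ Set.Icc (1/2 : ℝ) 1

/-- The number of visits of the path `x` to the site `x n` at times `m < n`. -/
def prevVisits (x : ℕ → ℤ) (n : ℕ) : ℕ :=
  ((Finset.range n).filter fun m => x m = x n).card

/-- The probability of the step from `x n` to `x (n+1)` for the multi-excited random
walk: jump to the right with the strength of the bottom remaining cookie at the current
site, to the left with the complementary probability. -/
def stepProb (ω : CEnv) (x : ℕ → ℤ) (n : ℕ) : ℝ :=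
  if x (n+1) = x n + 1 then ω (x n) (prevVisits x n)
  else if x (n+1) = x n - 1 then 1 - ω (x n) (prevVisits x n)
  else 0

/-- The probability that the walk started at `x0` follows the path `x` up to time `n`. -/
def cylProb (ω : CEnv) (x0 : ℤ) (x : ℕ → ℤ) (n : ℕ) : ℝ :=
  (if x 0 = x0 then 1 else 0) * ∏ m ∈ Finset.range n, stepProb ω x m

/-- `P` is the law `P_{x0,ω}` of the multi-excited random walk in the cookie
environment `ω` started at `x0`, characterized by its cylinder probabilities. -/
def IsERWLaw (ω : CEnv) (x0 : ℤ) (P : Measure (ℕ → ℤ)) : Prop :=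
  IsProbabilityMeasure P ∧
    ∀ (x : ℕ → ℤ) (n : ℕ),
      P {Y | ∀ m ≤ n, Y m = x m} = ENNReal.ofReal (cylProb ω x0 x n)

/-- First passage time `T_k`, with value `∞` if `k` is never visited. -/
def T (k : ℤ) (Y : ℕ → ℤ) : ℕ∞ :=
  sInf {t : ℕ∞ | ∃ n : ℕ, (n : ℕ∞) = t ∧ Y n = k}

/-- First passage time of an extended-real level, with the convention
`T_{−∞} = T_{+∞} = ∞`. -/
def Te (k : EReal) (Y : ℕ → ℤ) : ℕ∞ :=
  sInf {t : ℕ∞ | ∃ n : ℕ, (n : ℕ∞) = t ∧ ((Y n : ℝ) : EReal) = k}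

/-- `R_k`, the event that the site `k` is visited infinitely often. -/
def Rset (k : ℤ) : Set (ℕ → ℤ) := {Y | ∀ N : ℕ, ∃ n ≥ N, Y n = k}

/-- The number of visits of `Y` to the site `s` at times `< t`. -/
def visitsBefore (Y : ℕ → ℤ) (s : ℤ) (t : ℕ∞) : ℕ∞ :=
  {m : ℕ | (m : ℕ∞) < t ∧ Y m = s}.encard

/-- `D_t^s`: the total drift stored in the cookies consumed at the site `s`
before time `t` (a time in `ℕ∞`; `t = ∞` gives `D_∞^s`). -/
def driftAt (ω : CEnv) (Y : ℕ → ℤ) (s : ℤ) (t : ℕ∞) : ℝ≥0∞ :=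
  ∑' i : ℕ, Set.indicator {i : ℕ | (i : ℕ∞) < visitsBefore Y s t}
    (fun i => ENNReal.ofReal (2 * ω s i - 1)) i

/-- `D_t`: the total drift consumed before time `t` (at all sites). -/
def Dtot (ω : CEnv) (Y : ℕ → ℤ) (t : ℕ∞) : ℝ≥0∞ := ∑' s : ℤ, driftAt ω Y s t

/-- `D_t^+`: the total drift consumed at nonnegative sites before time `t`. -/
def DtotPos (ω : CEnv) (Y : ℕ → ℤ) (t : ℕ∞) : ℝ≥0∞ := ∑' s : ℕ, driftAt ω Y (s : ℤ) t

/-- `δ^s`: the total drift stored in the cookies at the site `s`. -/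
def cookieDrift (ω : CEnv) (s : ℤ) : ℝ≥0∞ := ∑' i : ℕ, ENNReal.ofReal (2 * ω s i - 1)

/-- The successive times `τ_{k,1}, τ_{k,2}, …` (indexed here from `0`) at which the
walk is at a site `≥ k`. -/
def tauT (k : ℤ) (Y : ℕ → ℤ) : ℕ → ℕ∞
  | 0 => sInf {t : ℕ∞ | ∃ n : ℕ, (n : ℕ∞) = t ∧ k ≤ Y n}
  | m + 1 => sInf {t : ℕ∞ | ∃ n : ℕ, (n : ℕ∞) = t ∧ tauT k Y m < (n : ℕ∞) ∧ k ≤ Y n}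

/-- The observed sequence `(X_{τ_{k,m}})_{m ≥ 1}` (indexed here from `0`). -/
def obsSeq (k : ℤ) (Y : ℕ → ℤ) (m : ℕ) : ℤ := Y (tauT k Y m).toNat

/-- The one-sided shift on sequences. -/
def shiftSeq {α : Type*} (u : ℕ → α) : ℕ → α := fun n => u (n + 1)

/-- The restriction `(ω(x))_{x ≥ 0}` of an environment to the nonnegative sites. -/
def restrictNN (ω : CEnv) : ℕ → ℕ → ℝ := fun x => ω (x : ℤ)

/-- `(ω(x))_{x ≥ 0}` is stationary under `Pr`: its law is invariant under the shift. -/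
def IsStationaryEnv (Pr : Measure CEnv) : Prop :=
  MeasurePreserving shiftSeq (Pr.map restrictNN) (Pr.map restrictNN)

/-- `(ω(x))_{x ≥ 0}` is stationary and ergodic under `Pr`. -/
def IsStatErgEnv (Pr : Measure CEnv) : Prop :=
  Ergodic shiftSeq (Pr.map restrictNN)

/-- The process `ξ_k = ((ω(x+k))_{x≥0}, (X_{τ_{k,m}} − k)_{m≥0})` consisting of the
environment to the right of `k` and the trajectory at sites `≥ k`, recentered at `k`. -/
def xiProc (p : CEnv × (ℕ → ℤ)) (k : ℕ) : (ℕ → ℕ → ℝ) × (ℕ → ℤ) :=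
  (fun x : ℕ => p.1 ((x : ℤ) + (k : ℤ)), fun m => obsSeq (k : ℤ) p.2 m - (k : ℤ))

/-- The number of visits of the path `X` to the site `u` at times `m < n`. -/
def visits (X : ℕ → ℤ) (n : ℕ) (u : ℤ) : ℕ :=
  ((Finset.range n).filter fun m => X m = u).card

/-- The displacement encoded by an arrow: `true` points right and `false` points left. -/
def arrowStep (b : Bool) : ℤ := if b then 1 else -1

/-- The path `X` follows the stacks of arrows `a`: at its `(i+1)`-st visit to the site `u`
it makes the step prescribed by `a (u, i)`. -/
def FollowsArrows (a : ℤ × ℕ → Bool) (X : ℕ → ℤ) : Prop :=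
  ∀ n, X (n + 1) = X n + arrowStep (a (X n, visits X n (X n)))

/-- The number of arrows in direction `b` among the first `k` arrows at the site `u`. -/
def arrowCount (a : ℤ × ℕ → Bool) (b : Bool) (u : ℤ) (k : ℕ) : ℕ :=
  ((Finset.range k).filter fun i => a (u, i) = b).card

lemma visits_zero (X : ℕ → ℤ) (u : ℤ) : visits X 0 u = 0 := by simp [visits]

lemma visits_succ (X : ℕ → ℤ) (n : ℕ) (u : ℤ) :
    visits X (n + 1) u = visits X n u + if X n = u then 1 else 0 := by
  unfold visits
  rw [Finset.range_add_one, Finset.filter_insert]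
  split_ifs <;> simp

lemma visits_mono (X : ℕ → ℤ) (u : ℤ) : Monotone fun n => visits X n u :=
  monotone_nat_of_le_succ fun n => by simp [visits_succ]

lemma visits_eq_zero_iff {X : ℕ → ℤ} {n : ℕ} {u : ℤ} :
    visits X n u = 0 ↔ ∀ m < n, X m ≠ u := by
  simp [visits, Finset.filter_eq_empty_iff]

lemma visits_congr {X Y : ℕ → ℤ} {n : ℕ} (h : ∀ m < n, X m = Y m) (u : ℤ) :
    visits X n u = visits Y n u := by
  unfold visits
  congr 1
  exact Finset.filter_congr fun m hm => by rw [h m (Finset.mem_range.1 hm)]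

lemma visits_neg (X : ℕ → ℤ) (n : ℕ) (u : ℤ) :
    visits (fun m => -X m) n u = visits X n (-u) := by
  simp [visits, neg_eq_iff_eq_neg]

lemma sum_visits {X : ℕ → ℤ} {n : ℕ} {S : Finset ℤ} (h : ∀ m < n, X m ∈ S) :
    ∑ u ∈ S, visits X n u = n := by
  have := Finset.card_eq_sum_card_fiberwise (s := Finset.range n) (t := S) (f := X)
    (fun m hm => h m (by simpa using hm))
  rw [Finset.card_range] at this
  exact this.symm

lemma arrowCount_succ (a : ℤ × ℕ → Bool) (b : Bool) (u : ℤ) (k : ℕ) :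
    arrowCount a b u (k + 1) = arrowCount a b u k + if a (u, k) = b then 1 else 0 := by
  unfold arrowCount
  rw [Finset.range_add_one, Finset.filter_insert]
  split_ifs <;> simp

lemma arrowCount_mono (a : ℤ × ℕ → Bool) (b : Bool) (u : ℤ) : Monotone (arrowCount a b u) :=
  monotone_nat_of_le_succ fun k => by simp [arrowCount_succ]

lemma arrowCount_true_add_false (a : ℤ × ℕ → Bool) (u : ℤ) (k : ℕ) :
    arrowCount a true u k + arrowCount a false u k = k := by
  induction k with
  | zero => simp [arrowCount]
  | succ k ih =>
    rw [arrowCount_succ, arrowCount_succ]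
    cases a (u, k) <;> simp <;> omega

/-- The difference between the numbers of right and left crossings of an edge only depends on
the endpoints of the path. -/
lemma FollowsArrows.crossings {a : ℤ × ℕ → Bool} {X : ℕ → ℤ} (h : FollowsArrows a X)
    (n : ℕ) (u : ℤ) :
    arrowCount a true u (visits X n u) + (if u < X 0 then 1 else 0)
      = arrowCount a false (u + 1) (visits X n (u + 1)) + if u < X n then 1 else 0 := by
  induction n with
  | zero => simp [visits_zero, arrowCount]
  | succ n ih =>
    have hn := h n
    rw [visits_succ, visits_succ]
    by_cases h1 : X n = u
    · have h2 : X n ≠ u + 1 := by omega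
      rw [if_pos h1, if_neg h2, arrowCount_succ, add_zero]
      rw [h1] at hn ih
      rw [hn]
      cases a (u, visits X n u) <;> simp [arrowStep] at ih ⊢ <;> omega
    · by_cases h2 : X n = u + 1
      · rw [if_neg h1, if_pos h2, arrowCount_succ, add_zero]
        rw [h2] at hn ih
        rw [hn]
        cases a (u + 1, visits X n (u + 1)) <;> simp [arrowStep] at ih ⊢ <;> omega
      · rw [if_neg h1, if_neg h2, add_zero, add_zero, ih, hn]
        unfold arrowStep
        split_ifs <;> omega

lemma FollowsArrows.neg {a : ℤ × ℕ → Bool} {X : ℕ → ℤ} (h : FollowsArrows a X) :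
    FollowsArrows (fun p => !a (-p.1, p.2)) fun n => -X n := by
  intro n
  have hn := h n
  simp only [visits_neg, neg_neg]
  rw [hn]
  cases a (X n, visits X n (X n)) <;> simp [arrowStep] <;> ring

/-- If two paths follow the same arrows and the left one reaches the site `z` to the right of
both starting points, then the right one reaches `z` no later, using no other arrows. -/
lemma FollowsArrows.exists_hit_right {a : ℤ × ℕ → Bool} {X₁ X₂ : ℕ → ℤ}
    (h₁ : FollowsArrows a X₁) (h₂ : FollowsArrows a X₂) (h12 : X₁ 0 ≤ X₂ 0) {z : ℤ}
    (hz : X₂ 0 ≤ z) {τ : ℕ} (hτ : X₁ τ = z) :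
    ∃ m ≤ τ, X₂ m = z ∧ ∀ u, visits X₂ m u ≤ visits X₁ τ u := by
  have key : ∀ n, (∀ m < n, X₂ m < z) → ∀ u, visits X₂ n u ≤ visits X₁ τ u := by
    intro n
    induction n with
    | zero => intro _ u; simp [visits_zero]
    | succ n ih =>
      intro hn u
      have ih' := ih fun m hm => hn m (by omega)
      rw [visits_succ]
      split_ifs with hu
      · have hlt := hn n (by omega)
        have c1 := h₁.crossings τ u
        have c1' := h₁.crossings τ (u - 1)
        have c2 := h₂.crossings n u
        have c2' := h₂.crossings n (u - 1)
        rw [sub_add_cancel] at c1' c2'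
        have s1 := arrowCount_true_add_false a u (visits X₁ τ u)
        have s2 := arrowCount_true_add_false a u (visits X₂ n u)
        have m1 := arrowCount_mono a false u (ih' u)
        have m2 := arrowCount_mono a true (u - 1) (ih' (u - 1))
        have m3 := arrowCount_mono a false (u + 1) (ih' (u + 1))
        split_ifs at c1 c1' c2 c2' <;> omega
      · exact ih' u
  have hex : ∃ m, m ≤ τ ∧ z ≤ X₂ m := by
    by_contra! hcon
    have hle := key (τ + 1) fun m hm => hcon m (by omega)
    have e1 := sum_visits (X := X₁) (n := τ)
      (S := (Finset.range (τ + 1)).image X₁ ∪ (Finset.range (τ + 1)).image X₂) fun m hm =>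
        Finset.mem_union_left _ (Finset.mem_image_of_mem _ (by simp; omega))
    have e2 := sum_visits (X := X₂) (n := τ + 1)
      (S := (Finset.range (τ + 1)).image X₁ ∪ (Finset.range (τ + 1)).image X₂) fun m hm =>
        Finset.mem_union_right _ (Finset.mem_image_of_mem _ (by simpa using hm))
    have := Finset.sum_le_sum fun u
      (_ : u ∈ (Finset.range (τ + 1)).image X₁ ∪ (Finset.range (τ + 1)).image X₂) => hle u
    omega
  have hm := Nat.find_spec hex
  have hmin : ∀ m < Nat.find hex, X₂ m < z := fun m hlt => by
    have := Nat.find_min hex hlt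
    push Not at this
    exact this (by omega)
  refine ⟨Nat.find hex, hm.1, le_antisymm ?_ hm.2, key _ hmin⟩
  rcases hk : Nat.find hex with _ | k
  · exact hz
  · have := hmin k (by omega)
    rw [h₂ k]
    unfold arrowStep
    split_ifs <;> omega

/-- The mirror image of `FollowsArrows.exists_hit_right`. -/
lemma FollowsArrows.exists_hit_left {a : ℤ × ℕ → Bool} {X₁ X₂ : ℕ → ℤ}
    (h₁ : FollowsArrows a X₁) (h₂ : FollowsArrows a X₂) (h12 : X₁ 0 ≤ X₂ 0) {x : ℤ}
    (hx : x ≤ X₁ 0) {τ : ℕ} (hτ : X₂ τ = x) :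
    ∃ m ≤ τ, X₁ m = x ∧ ∀ u, visits X₁ m u ≤ visits X₂ τ u := by
  obtain ⟨m, hm, hmx, hv⟩ := h₂.neg.exists_hit_right h₁.neg (neg_le_neg h12)
    (neg_le_neg hx) (τ := τ) (by simp [hτ])
  refine ⟨m, hm, neg_injective hmx, fun u => ?_⟩
  simpa [visits_neg] using hv (-u)

lemma le_Te_iff {k : EReal} {Y : ℕ → ℤ} {c : ℕ∞} :
    c ≤ Te k Y ↔ ∀ n : ℕ, ((Y n : ℝ) : EReal) = k → c ≤ n := by
  unfold Te
  rw [le_sInf_iff]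
  exact ⟨fun h n hn => h _ ⟨n, rfl, hn⟩, by rintro h _ ⟨n, rfl, hn⟩; exact h n hn⟩

lemma Te_le {k : EReal} {Y : ℕ → ℤ} {n : ℕ} (h : ((Y n : ℝ) : EReal) = k) : Te k Y ≤ n :=
  sInf_le ⟨n, rfl, h⟩

lemma exists_of_Te_lt_top {k : EReal} {Y : ℕ → ℤ} (h : Te k Y < ⊤) :
    ∃ n : ℕ, Te k Y = n ∧ ((Y n : ℝ) : EReal) = k := by
  have hne : {t : ℕ∞ | ∃ n : ℕ, (n : ℕ∞) = t ∧ ((Y n : ℝ) : EReal) = k}.Nonempty := by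
    by_contra hne
    rw [Set.not_nonempty_iff_eq_empty] at hne
    simp [Te, hne] at h
  obtain ⟨n, hn, hk⟩ := csInf_mem hne
  exact ⟨n, hn.symm, hk⟩

/-- If before time `m` the path `Y` visits no site more often than `X` does before time `n`, and
`X` does not hit the level `k` before time `n`, then `Y` does not hit `k` before time `m`. -/
lemma le_Te_of_visits_le {X Y : ℕ → ℤ} {m n : ℕ} (h : ∀ u, visits Y m u ≤ visits X n u)
    {k : EReal} (hk : (n : ℕ∞) ≤ Te k X) : (m : ℕ∞) ≤ Te k Y := by
  rw [le_Te_iff]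
  intro j hj
  by_contra! hlt
  have hlt : j < m := by exact_mod_cast hlt
  have h0 : visits X n (Y j) = 0 := visits_eq_zero_iff.2 fun i hi hij => by
    have := le_Te_iff.1 hk i (by rw [hij, hj])
    exact absurd this (by simpa using hi)
  exact visits_eq_zero_iff.1 (Nat.le_zero.1 (h0 ▸ h (Y j))) j hlt rfl

lemma FollowsArrows.Te_le_min {a : ℤ × ℕ → Bool} {X₁ X₂ : ℕ → ℤ}
    (h₁ : FollowsArrows a X₁) (h₂ : FollowsArrows a X₂) (h12 : X₁ 0 ≤ X₂ 0) {x z : EReal}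
    (hx : x ≤ ((X₁ 0 : ℝ) : EReal)) (hz : ((X₂ 0 : ℝ) : EReal) ≤ z) {t : ℕ∞}
    (h : Te z X₁ ≤ min (Te x X₁) t) : Te z X₂ ≤ min (Te x X₂) t := by
  rw [le_min_iff] at h
  rcases eq_or_ne (Te z X₁) ⊤ with htop | hfin
  · rw [htop, top_le_iff, top_le_iff] at h
    rw [h.2, min_eq_left le_top]
    by_contra! hlt
    obtain ⟨τ, hτ, hτx⟩ := exists_of_Te_lt_top (hlt.trans_le le_top)
    obtain ⟨m, -, hm, -⟩ := h₁.exists_hit_left h₂ h12 (x := X₂ τ)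
      (by rw [← hτx] at hx; exact_mod_cast hx) rfl
    have := Te_le (k := x) (Y := X₁) (n := m) (by rw [hm, hτx])
    simp [h.1] at this
  · obtain ⟨τ, hτ, hτz⟩ := exists_of_Te_lt_top hfin.lt_top
    obtain ⟨m, hmτ, hm, hv⟩ := h₁.exists_hit_right h₂ h12 (z := X₁ τ)
      (by rw [← hτz] at hz; exact_mod_cast hz) rfl
    have hle : Te z X₂ ≤ m := Te_le (by rw [hm, hτz])
    refine le_min (hle.trans (le_Te_of_visits_le hv (hτ ▸ h.1))) (hle.trans ?_)
    exact le_trans (by exact_mod_cast hmτ) (hτ ▸ h.2)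

/-- The position and the visit counts, after `n` steps, of the walk started at `y` which follows
the arrows `a`. -/
def walkState (y : ℤ) (a : ℤ × ℕ → Bool) : ℕ → ℤ × (ℤ → ℕ)
  | 0 => (y, 0)
  | n + 1 =>
    ((walkState y a n).1 +
        arrowStep (a ((walkState y a n).1, (walkState y a n).2 (walkState y a n).1)),
      fun u => (walkState y a n).2 u + if (walkState y a n).1 = u then 1 else 0)

/-- The walk started at `y` which follows the arrows `a`. -/
def walk (y : ℤ) (a : ℤ × ℕ → Bool) (n : ℕ) : ℤ := (walkState y a n).1

lemma walkState_snd (y : ℤ) (a : ℤ × ℕ → Bool) (n : ℕ) (u : ℤ) :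
    (walkState y a n).2 u = visits (walk y a) n u := by
  induction n with
  | zero => simp [visits_zero, walkState]
  | succ n ih => rw [visits_succ, ← ih]; rfl

lemma followsArrows_walk (y : ℤ) (a : ℤ × ℕ → Bool) : FollowsArrows a (walk y a) := by
  intro n
  rw [← walkState_snd]
  rfl

lemma measurable_eval_comp {α ι β : Type*} [MeasurableSpace α] [MeasurableSpace ι]
    [MeasurableSpace β] [Countable ι] [MeasurableSingletonClass ι] {f : α → ι → β} {g : α → ι}
    (hf : ∀ i, Measurable fun a => f a i) (hg : Measurable g) :
    Measurable fun a => f a (g a) :=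
  (measurable_from_prod_countable_left (f := fun p : α × ι => f p.1 p.2) hf).comp
    (measurable_id.prodMk hg)

lemma measurable_walkState (y : ℤ) (n : ℕ) :
    Measurable (fun a => (walkState y a n).1) ∧
      ∀ u, Measurable fun a => (walkState y a n).2 u := by
  induction n with
  | zero => exact ⟨measurable_const, fun u => measurable_const⟩
  | succ n ih =>
    obtain ⟨h1, h2⟩ := ih
    refine ⟨h1.add ((measurable_of_countable arrowStep).comp
      (measurable_eval_comp (f := fun a : ℤ × ℕ → Bool => a) measurable_pi_apply
        (h1.prodMk (measurable_eval_comp h2 h1)))), fun u => (h2 u).add ?_⟩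
    exact (measurable_of_countable fun v : ℤ => if v = u then 1 else 0).comp h1

lemma measurable_walk (y : ℤ) : Measurable (walk y) :=
  measurable_pi_lambda _ fun n => (measurable_walkState y n).1

lemma measurable_Te (k : EReal) : Measurable (Te k) := by
  have hset : ∀ n : ℕ, MeasurableSet {Y : ℕ → ℤ | (n : ℕ∞) ≤ Te k Y} := by
    intro n
    simp only [le_Te_iff, Set.ofPred_forall]
    refine MeasurableSet.iInter fun m => ?_
    exact (Set.to_countable {v : ℤ | ((v : ℝ) : EReal) = k → (n : ℕ∞) ≤ m}).measurableSet.preimage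
      (measurable_pi_apply m)
  refine measurable_to_countable' fun c => ?_
  cases c with
  | top =>
    convert MeasurableSet.iInter hset using 1
    ext Y
    simp [ENat.eq_top_iff_forall_ge]
  | coe n =>
    convert (hset n).diff (hset (n + 1)) using 1
    ext Y
    simp only [Set.mem_preimage, Set.mem_singleton_iff, Set.mem_sdiff, Set.mem_ofPred_eq, not_le]
    rw [Nat.cast_add, Nat.cast_one, ENat.lt_add_one_iff (by simp)]
    exact ⟨fun h => ⟨h.ge, h.le⟩, fun h => le_antisymm h.2 h.1⟩

/-- The law of an arrow which points right with probability `p`. -/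
def arrowLaw (p : ℝ) : Measure Bool :=
  ENNReal.ofReal p • Measure.dirac true + ENNReal.ofReal (1 - p) • Measure.dirac false

lemma isProbabilityMeasure_arrowLaw {p : ℝ} (h0 : 0 ≤ p) (h1 : p ≤ 1) :
    IsProbabilityMeasure (arrowLaw p) := by
  refine ⟨?_⟩
  simp [arrowLaw, ← ENNReal.ofReal_add h0 (sub_nonneg.2 h1)]

/-- The law of independent stacks of arrows with the strengths prescribed by `ω`. -/
def arrowsLaw (ω : CEnv) : Measure (ℤ × ℕ → Bool) :=
  Measure.infinitePi fun p : ℤ × ℕ => arrowLaw (ω p.1 p.2)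

lemma walk_eq_on_iff {y : ℤ} {a : ℤ × ℕ → Bool} {x : ℕ → ℤ} {n : ℕ} :
    (∀ m ≤ n, walk y a m = x m) ↔
      x 0 = y ∧ ∀ m < n, x (m + 1) = x m + arrowStep (a (x m, prevVisits x m)) := by
  constructor
  · intro h
    refine ⟨(h 0 (Nat.zero_le n)).symm, fun m hm => ?_⟩
    have hv : prevVisits x m = visits (walk y a) m (x m) :=
      (visits_congr (fun j hj => h j (by omega)) _).symm
    rw [← h (m + 1) (by omega), followsArrows_walk, hv, h m (by omega)]
  · rintro ⟨h0, h⟩ m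
    induction m using Nat.strong_induction_on with
    | _ m ih =>
      intro hm
      rcases m with _ | m
      · exact h0.symm
      · have hv : prevVisits x m = visits (walk y a) m (x m) :=
          (visits_congr (fun j hj => ih j (by omega) (by omega)) _).symm
        rw [h m (by omega), followsArrows_walk, hv, ih m (by omega) (by omega)]

lemma visit_injective (x : ℕ → ℤ) : Function.Injective fun m => (x m, prevVisits x m) := by
  have key : ∀ m m', m < m' → x m = x m' → prevVisits x m < prevVisits x m' := by
    intro m m' hlt hx
    have h1 : visits x (m + 1) (x m) ≤ visits x m' (x m) := visits_mono x (x m) hlt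
    rw [visits_succ, if_pos rfl] at h1
    change visits x m (x m) < visits x m' (x m')
    rw [← hx]
    omega
  intro m m' h
  simp only [Prod.mk.injEq] at h
  rcases lt_trichotomy m m' with hlt | heq | hlt
  · exact absurd h.2 (key m m' hlt h.1).ne
  · exact heq
  · exact absurd h.2 (key m' m hlt h.1.symm).ne'

lemma arrowsLaw_walk_eq_on {ω : CEnv} (hω : IsCookieEnv ω) (y : ℤ) (x : ℕ → ℤ) (n : ℕ) :
    arrowsLaw ω {a | ∀ m ≤ n, walk y a m = x m} = ENNReal.ofReal (cylProb ω y x n) := by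
  have h0 : ∀ z i, 0 ≤ ω z i := fun z i => le_trans (by norm_num) (hω z i).1
  have h1 : ∀ z i, ω z i ≤ 1 := fun z i => (hω z i).2
  have := fun p : ℤ × ℕ => isProbabilityMeasure_arrowLaw (h0 p.1 p.2) (h1 p.1 p.2)
  simp only [walk_eq_on_iff]
  by_cases hy : x 0 = y
  swap
  · simp [hy, cylProb]
  have hstep0 : ∀ m, 0 ≤ stepProb ω x m := by
    intro m
    unfold stepProb
    split_ifs
    · exact h0 _ _
    · exact sub_nonneg.2 (h1 _ _)
    · exact le_rfl
  have hstep : ∀ m, arrowLaw (ω (x m) (prevVisits x m)) {b | x (m + 1) = x m + arrowStep b}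
      = ENNReal.ofReal (stepProb ω x m) := by
    intro m
    have e1 : (x m + 1 = x m - 1) ↔ False := by simp; omega
    have e2 : (x m - 1 = x m + 1) ↔ False := by simp; omega
    simp only [arrowLaw, Measure.add_apply, Measure.smul_apply, smul_eq_mul,
      Measure.dirac_apply, Set.indicator_apply, Set.mem_ofPred_eq, arrowStep, stepProb,
      Pi.one_apply, if_true, Bool.false_eq_true, if_false, ← sub_eq_add_neg]
    split_ifs with ha hb hb
    · exact absurd (ha.symm.trans hb) (by omega)
    all_goals simp
  let key : ℕ → ℤ × ℕ := fun m => (x m, prevVisits x m)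
  have hset : {a : ℤ × ℕ → Bool | x 0 = y ∧
        ∀ m < n, x (m + 1) = x m + arrowStep (a (x m, prevVisits x m))}
      = Set.pi ((Finset.range n).image key)
        fun p => {b | ∀ m, key m = p → x (m + 1) = x m + arrowStep b} := by
    ext a
    simp only [Set.mem_ofPred_eq, hy, true_and, Set.mem_pi, Finset.coe_image, Set.mem_image,
      Finset.coe_range, Set.mem_Iio, forall_exists_index, and_imp]
    constructor
    · rintro h _ m hm rfl m' hm'
      rw [visit_injective x hm']
      exact h m hm
    · intro h m hm
      exact h _ m hm rfl m rfl
  rw [hset, arrowsLaw, Measure.infinitePi_pi _ fun _ _ => Set.to_countable _ |>.measurableSet,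
    Finset.prod_image fun _ _ _ _ h => visit_injective x h, cylProb, if_pos hy, one_mul,
    ENNReal.ofReal_prod_of_nonneg fun m _ => hstep0 m]
  refine Finset.prod_congr rfl fun m _ => ?_
  rw [← hstep]
  congr 1
  ext b
  exact ⟨fun h => h m rfl, fun h m' hm' => by rw [visit_injective x hm']; exact h⟩

/-- Two finite measures on integer sequences which agree on all cylinders are equal. -/
lemma measure_ext_of_cylinders {μ ν : Measure (ℕ → ℤ)} [IsFiniteMeasure ν]
    (h : ∀ (x : ℕ → ℤ) (n : ℕ), μ {Y | ∀ m ≤ n, Y m = x m} = ν {Y | ∀ m ≤ n, Y m = x m}) :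
    μ = ν := by
  let Q : (I : Finset ℕ) → Measure (I → ℤ) := fun I => ν.map I.restrict
  have hν : IsProjectiveLimit (α := fun _ : ℕ => ℤ) ν Q := fun I => rfl
  have hQ : IsProjectiveMeasureFamily (α := fun _ : ℕ => ℤ) Q := fun I J hJI => by
    change _ = (ν.map I.restrict).map _
    rw [Measure.map_map (by fun_prop) (by fun_prop)]
    rfl
  have hμ : IsProjectiveLimit (α := fun _ : ℕ => ℤ) μ Q := by
    rw [isProjectiveLimit_nat_iff hQ]
    intro n
    refine Measure.ext_of_singleton fun v => ?_
    change _ = ν.map _ _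
    rw [Measure.map_apply (by fun_prop) (measurableSet_singleton v),
      Measure.map_apply (by fun_prop) (measurableSet_singleton v)]
    have hpre : (Preorder.frestrictLe n : (ℕ → ℤ) → _) ⁻¹' {v}
        = {Y | ∀ m ≤ n, Y m = if hm : m ≤ n then v ⟨m, Finset.mem_Iic.2 hm⟩ else 0} := by
      ext Y
      simp only [Set.mem_preimage, Set.mem_singleton_iff, funext_iff, Set.mem_ofPred_eq]
      constructor
      · intro hY m hm
        rw [dif_pos hm]
        exact hY ⟨m, Finset.mem_Iic.2 hm⟩
      · rintro hY ⟨m, hm⟩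
        have := hY m (Finset.mem_Iic.1 hm)
        rwa [dif_pos (Finset.mem_Iic.1 hm)] at this
    exact hpre ▸ h _ n
  exact hμ.unique hν

lemma IsERWLaw.eq_map_walk {ω : CEnv} (hω : IsCookieEnv ω) {y : ℤ} {P : Measure (ℕ → ℤ)}
    (hP : IsERWLaw ω y P) : P = (arrowsLaw ω).map (walk y) := by
  have := hP.1
  refine (measure_ext_of_cylinders fun x n => ?_).symm
  have hmeas : MeasurableSet {Y : ℕ → ℤ | ∀ m ≤ n, Y m = x m} := by
    simp only [Set.ofPred_forall]
    exact MeasurableSet.iInter fun m => MeasurableSet.iInter fun _ =>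
      measurableSet_eq_fun (measurable_pi_apply m) measurable_const
  rw [hP.2, Measure.map_apply (measurable_walk y) hmeas, ← arrowsLaw_walk_eq_on hω]
  rfl

/-- Lemma 18, monotonicity w.r.t. the initial point. For
`−∞ ≤ x ≤ y₁ ≤ y₂ ≤ z ≤ ∞` (with `y₁, y₂ ∈ ℤ`) and any time horizon `t ≤ ∞`,
`P_{y₁,ω}[T_z ≤ T_x ∧ t] ≤ P_{y₂,ω}[T_z ≤ T_x ∧ t]`. -/
theorem erw_monotone_initial_point (ω : CEnv) (hω : IsCookieEnv ω)
    (x z : EReal) (y₁ y₂ : ℤ)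
    (hx : x ≤ ((y₁ : ℝ) : EReal)) (h12 : y₁ ≤ y₂) (hz : ((y₂ : ℝ) : EReal) ≤ z)
    (t : ℕ∞)
    (P₁ P₂ : Measure (ℕ → ℤ)) (hP₁ : IsERWLaw ω y₁ P₁) (hP₂ : IsERWLaw ω y₂ P₂) :
    P₁ {Y | Te z Y ≤ min (Te x Y) t} ≤ P₂ {Y | Te z Y ≤ min (Te x Y) t} := by
  have hE : MeasurableSet {Y : ℕ → ℤ | Te z Y ≤ min (Te x Y) t} :=
    ((measurable_Te z).prodMk (measurable_Te x))
      (Set.to_countable {p : ℕ∞ × ℕ∞ | p.1 ≤ min p.2 t}).measurableSet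
  rw [hP₁.eq_map_walk hω, hP₂.eq_map_walk hω, Measure.map_apply (measurable_walk y₁) hE,
    Measure.map_apply (measurable_walk y₂) hE]
  exact measure_mono fun a ha =>
    (followsArrows_walk y₁ a).Te_le_min (followsArrows_walk y₂ a) h12 hx hz ha

end
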